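/- Let K ⊂ ℝⁿ be a convex body with dim K = n and let Λ ⊂ ℝⁿ be a full-rank lattice. Then, with K_s = (1/2)(K-K), the number of lattice points in K satisfies #(K ∩ Λ) ≤ ⌊2/λ₁(K_s,Λ) + 1⌋ⁿ. -/

import Mathlib

open MeasureTheory Pointwise

/-- The lattice `Bℤⁿ ⊆ ℝⁿ` generated by the (invertible) matrix `B`. -/
def latticeOf {n : ℕ} (B : Matrix (Fin n) (Fin n) ℝ) : Set (Fin n → ℝ) :=
  {x | ∃ z : Fin n → ℤ, x = B.mulVec (fun i => (z i : ℝ))}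

/-- The `j`-th successive minimum of a set `K ⊆ ℝⁿ` with respect to a set of
lattice points `Λ ⊆ ℝⁿ`: the infimum of all `λ > 0` such that `λ • K` contains
at least `j` linearly independent points of `Λ`. -/
noncomputable def succMin {n : ℕ} (K Λ : Set (Fin n → ℝ)) (j : ℕ) : ℝ :=
  sInf {lam : ℝ | 0 < lam ∧ ∃ v : Fin j → (Fin n → ℝ),
    LinearIndependent ℝ v ∧ ∀ k, v k ∈ Λ ∧ v k ∈ lam • K}

/-- Two distinct lattice points of a set that are congruent modulo `p` produce a nonzero
lattice point in the `2 / p` dilate of the central symmetral. -/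
theorem exists_lattice_point_of_lt_ncard {n p : ℕ} (hp : 0 < p) (B : Matrix (Fin n) (Fin n) ℝ)
    (K : Set (Fin n → ℝ)) (h : p ^ n < (K ∩ latticeOf B).ncard) :
    ∃ v ∈ latticeOf B, v ≠ 0 ∧ v ∈ (2 / p : ℝ) • ((2⁻¹ : ℝ) • (K - K)) := by
  have : NeZero p := ⟨hp.ne'⟩
  have hp0 : (p : ℝ) ≠ 0 := by exact_mod_cast hp.ne'
  have hcoord : ∀ x : Fin n → ℝ, ∃ z : Fin n → ℤ,
      x ∈ latticeOf B → x = B.mulVec (fun i => (z i : ℝ)) := fun x => by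
    by_cases hx : x ∈ latticeOf B
    · obtain ⟨z, hz⟩ := hx
      exact ⟨z, fun _ => hz⟩
    · exact ⟨0, fun h => absurd h hx⟩
  choose coord hcoord using hcoord
  obtain ⟨x, hx, y, hy, hxy, hmod⟩ := Set.exists_ne_map_eq_of_ncard_lt_of_maps_to
    (s := K ∩ latticeOf B) (t := (Set.univ : Set (Fin n → ZMod p)))
    (f := fun x i => (coord x i : ZMod p))
    (by rw [Set.ncard_univ]; simpa using h) (fun _ _ => Set.mem_univ _)
  have hdvd : ∀ i, ∃ w : ℤ, coord x i - coord y i = p * w := fun i =>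
    ((ZMod.intCast_eq_intCast_iff_dvd_sub _ _ p).1 (congrFun hmod i).symm)
  choose w hw using hdvd
  have hsub : x - y = (p : ℝ) • B.mulVec (fun i => (w i : ℝ)) := by
    rw [hcoord x hx.2, hcoord y hy.2, ← Matrix.mulVec_sub, ← Matrix.mulVec_smul]
    congr 1
    ext i
    simpa using congrArg (Int.cast : ℤ → ℝ) (hw i)
  refine ⟨_, ⟨w, rfl⟩, fun h0 => hxy ?_, ?_⟩
  · rwa [h0, smul_zero, sub_eq_zero] at hsub
  · refine Set.mem_smul_set.2 ⟨_, Set.smul_mem_smul_set (Set.sub_mem_sub hx.1 hy.1), ?_⟩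
    rw [hsub, smul_smul, smul_smul]
    convert one_smul ℝ _
    field_simp

/-- The dilation factors for which a bounded set meets a full-rank lattice outside the origin are
bounded away from zero. -/
theorem exists_pos_le_of_mem_smul {n : ℕ} {B : Matrix (Fin n) (Fin n) ℝ} (hB : B.det ≠ 0)
    {C : Set (Fin n → ℝ)} (hC : IsCompact C) :
    ∃ c : ℝ, 0 < c ∧ ∀ lam : ℝ, 0 < lam → ∀ v ∈ latticeOf B, v ≠ 0 → v ∈ lam • C → c ≤ lam := by
  have hcont : Continuous fun u : Fin n → ℝ => B⁻¹.mulVec u := by fun_prop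
  obtain ⟨R, hR, hbound⟩ := (hC.image hcont).isBounded.exists_pos_norm_le
  refine ⟨R⁻¹, inv_pos.2 hR, ?_⟩
  rintro lam hlam v ⟨z, rfl⟩ hv ⟨u, hu, huv⟩
  have hz : (fun i => (z i : ℝ)) = lam • B⁻¹.mulVec u := by
    rw [← Matrix.mulVec_smul]
    change lam • u = _ at huv
    rw [huv, Matrix.mulVec_mulVec, Matrix.nonsing_inv_mul _ (isUnit_iff_ne_zero.2 hB),
      Matrix.one_mulVec]
  obtain ⟨i, hi⟩ : ∃ i, z i ≠ 0 := by
    by_contra! hz0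
    apply hv
    simp only [hz0, Int.cast_zero]
    exact Matrix.mulVec_zero B
  have hone : (1 : ℝ) ≤ |(z i : ℝ)| := by exact_mod_cast Int.one_le_abs hi
  have hle : |(z i : ℝ)| ≤ lam * R := calc
    |(z i : ℝ)| ≤ ‖fun i => (z i : ℝ)‖ := norm_le_pi_norm (fun i => (z i : ℝ)) i
    _ = lam * ‖B⁻¹.mulVec u‖ := by rw [hz, norm_smul, Real.norm_of_nonneg hlam.le]
    _ ≤ lam * R := by gcongr; exact hbound _ ⟨u, hu, rfl⟩
  rw [inv_le_iff_one_le_mul₀ hR]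
  exact hone.trans hle

theorem succMin_nonneg {n : ℕ} (K Λ : Set (Fin n → ℝ)) (j : ℕ) : 0 ≤ succMin K Λ j :=
  Real.sInf_nonneg fun _ h => h.1.le

/-- A nonzero lattice point in a dilate of a compact set bounds the first minimum from above, and
forces it to be positive. -/
theorem succMin_one_pos_and_le {n : ℕ} {B : Matrix (Fin n) (Fin n) ℝ} (hB : B.det ≠ 0)
    {C : Set (Fin n → ℝ)} (hC : IsCompact C) {lam : ℝ} (hlam : 0 < lam) {v : Fin n → ℝ}
    (hv : v ∈ latticeOf B) (hv0 : v ≠ 0) (hvC : v ∈ lam • C) :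
    0 < succMin C (latticeOf B) 1 ∧ succMin C (latticeOf B) 1 ≤ lam := by
  obtain ⟨c, hc, hle⟩ := exists_pos_le_of_mem_smul hB hC
  have hmem : lam ∈ {lam : ℝ | 0 < lam ∧ ∃ v : Fin 1 → (Fin n → ℝ),
      LinearIndependent ℝ v ∧ ∀ k, v k ∈ latticeOf B ∧ v k ∈ lam • C} :=
    ⟨hlam, fun _ => v, linearIndependent_unique_iff.2 hv0, fun _ => ⟨hv, hvC⟩⟩
  refine ⟨hc.trans_le (le_csInf ⟨lam, hmem⟩ ?_), csInf_le ⟨0, fun _ h => h.1.le⟩ hmem⟩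
  rintro μ ⟨hμ, u, hu, huC⟩
  exact hle μ hμ (u 0) (huC 0).1 (hu.ne_zero 0) (huC 0).2

/-- Betke–Henk–Wills / Malikiosis: For a convex body `K ⊆ ℝⁿ`
with `dim K = n`, a full-rank lattice `Λ = Bℤⁿ`, and `K_s = (1/2)(K - K)`,
the number of lattice points in `K` satisfies
`#(K ∩ Λ) ≤ ⌊2/λ₁(K_s,Λ) + 1⌋ⁿ`. -/
theorem stmt_18 (n : ℕ) (B : Matrix (Fin n) (Fin n) ℝ) (hB : B.det ≠ 0)
    (K : Set (Fin n → ℝ)) (hKconv : Convex ℝ K) (hKcomp : IsCompact K)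
    (hKdim : (interior K).Nonempty) :
    ((K ∩ latticeOf B).ncard : ℝ) ≤
      ((⌊2 / succMin ((2⁻¹ : ℝ) • (K - K)) (latticeOf B) 1 + 1⌋ : ℤ) : ℝ) ^ n := by
  set m := succMin ((2⁻¹ : ℝ) • (K - K)) (latticeOf B) 1 with hm
  have hm0 : 0 ≤ m := succMin_nonneg _ _ _
  have hfloor : 1 ≤ ⌊2 / m + 1⌋ := Int.le_floor.2 (by push_cast; linarith [div_nonneg zero_le_two hm0])
  obtain ⟨p, hp⟩ := Int.eq_ofNat_of_zero_le (zero_le_one.trans hfloor)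
  have hppos : 0 < p := by omega
  have hpR : (0 : ℝ) < p := by exact_mod_cast hppos
  rw [hp]
  by_contra! hlt
  obtain ⟨v, hv, hv0, hvK⟩ :=
    exists_lattice_point_of_lt_ncard hppos B K (by exact_mod_cast hlt)
  obtain ⟨hmpos, hmle⟩ := succMin_one_pos_and_le hB
    ((sub_eq_add_neg K K ▸ hKcomp.add hKcomp.neg).smul (2⁻¹ : ℝ)) (by positivity) hv hv0 hvK
  rw [← hm] at hmpos hmle
  have hp_le : (p : ℝ) ≤ 2 / m := by
    rw [le_div_iff₀ hpR] at hmle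
    rw [le_div_iff₀ hmpos]
    linarith
  have hlt_p := Int.lt_floor_add_one (2 / m + 1)
  rw [hp] at hlt_p
  push_cast at hlt_p
  linarith
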